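/- Let g, u : [0,1] → ℝ be measurable functions, and let v : [0,1] × [0,1] → ℝ be measurable such that for almost every τ ∈ [0,1] the function t ↦ v(t,τ) is integrable on [0,1], and such that (t,τ) ↦ (v(t,τ) − u(τ))² is integrable on [0,1]². Define the transported map T(τ) = g(τ) + ∫₀¹ v(t,τ) dt and the target map F(τ) = g(τ) + u(τ), and let η = T_# Unif[0,1] and ν = F_# Unif[0,1] be the pushforward probability measures on ℝ. Then W₂²(η, ν) ≤ ∫₀¹ ∫₀¹ (v(t,τ) − u(τ))² dt dτ; that is, the quantile-coupled flow-matching loss upper-bounds the squared 2-Wasserstein distance between the model return distribution and the target return distribution. -/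

import Mathlib

open MeasureTheory

/-- The uniform (Lebesgue) probability measure on `[0,1]`. -/
noncomputable def unif01 : Measure ℝ := volume.restrict (Set.Icc (0 : ℝ) 1)

/-- Squared 2-Wasserstein distance between two measures on `ℝ`, defined as the infimum
of the expected squared difference over all couplings. -/
noncomputable def W2sq (μ ν : Measure ℝ) : ℝ :=
  sInf { c : ℝ | ∃ π : Measure (ℝ × ℝ), IsProbabilityMeasure π ∧
    π.map Prod.fst = μ ∧ π.map Prod.snd = ν ∧ c = ∫ p, (p.1 - p.2) ^ 2 ∂π }

/-- **Conditional Wasserstein upper bound (Proposition 1).**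
The quantile-coupled flow-matching loss upper-bounds the squared 2-Wasserstein distance
between the model return distribution and the target return distribution. -/
theorem flowiqn_w2_upper_bound
    (g u : ℝ → ℝ) (v : ℝ → ℝ → ℝ)
    (hg : Measurable g) (hu : Measurable u)
    (hv : Measurable fun p : ℝ × ℝ => v p.1 p.2)
    (hint : ∀ᵐ τ ∂unif01, IntegrableOn (fun t => v t τ) (Set.Icc (0 : ℝ) 1))
    (hL : Integrable (fun p : ℝ × ℝ => (v p.1 p.2 - u p.2) ^ 2) (unif01.prod unif01))
    (T F : ℝ → ℝ)
    (hT : T = fun τ => g τ + ∫ t in Set.Icc (0 : ℝ) 1, v t τ)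
    (hF : F = fun τ => g τ + u τ) :
    W2sq (unif01.map T) (unif01.map F)
      ≤ ∫ τ in Set.Icc (0 : ℝ) 1, ∫ t in Set.Icc (0 : ℝ) 1, (v t τ - u τ) ^ 2 := by
  have hP : IsProbabilityMeasure unif01 := ⟨by simp [unif01]⟩
  have hTm : Measurable T := by
    rw [hT]
    refine hg.add ?_
    have h := hv.stronglyMeasurable.integral_prod_left' (μ := unif01)
    exact h.measurable
  have hFm : Measurable F := by
    rw [hF]
    exact hg.add hu
  have hTF : Measurable fun τ => (T τ, F τ) := hTm.prodMk hFm
  have h1 : W2sq (unif01.map T) (unif01.map F) ≤ ∫ τ, (T τ - F τ) ^ 2 ∂unif01 := by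
    unfold W2sq
    refine csInf_le ⟨0, ?_⟩ ⟨unif01.map (fun τ => (T τ, F τ)), ?_, ?_, ?_, ?_⟩
    · rintro c ⟨π, -, -, -, rfl⟩
      exact integral_nonneg fun p => sq_nonneg _
    · exact Measure.isProbabilityMeasure_map hTF.aemeasurable
    · rw [Measure.map_map measurable_fst hTF]; rfl
    · rw [Measure.map_map measurable_snd hTF]; rfl
    · rw [integral_map hTF.aemeasurable]
      exact (by fun_prop : Measurable fun p : ℝ × ℝ => (p.1 - p.2) ^ 2).aestronglyMeasurable
  refine h1.trans ?_
  change _ ≤ ∫ τ, ∫ t, (v t τ - u τ) ^ 2 ∂unif01 ∂unif01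
  refine integral_mono_of_nonneg (Filter.Eventually.of_forall fun τ => sq_nonneg _)
    hL.integral_prod_right ?_
  filter_upwards [hint, hL.prod_left_ae] with τ h2 h3
  have h2' : Integrable (fun t => v t τ) unif01 := h2
  have hw : Integrable (fun t => v t τ - u τ) unif01 := h2'.sub (integrable_const _)
  have hm : T τ - F τ = ∫ t, (v t τ - u τ) ∂unif01 := by
    rw [integral_sub h2' (integrable_const _), hT, hF]
    simp [unif01]
  set m := T τ - F τ with hmdef
  have h4 : 0 ≤ ∫ t, ((v t τ - u τ) ^ 2 - (2 * m * (v t τ - u τ) - m ^ 2)) ∂unif01 := by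
    refine integral_nonneg fun t => ?_
    change 0 ≤ (v t τ - u τ) ^ 2 - (2 * m * (v t τ - u τ) - m ^ 2)
    nlinarith [sq_nonneg (v t τ - u τ - m)]
  have h5 : Integrable (fun t => 2 * m * (v t τ - u τ) - m ^ 2) unif01 :=
    (hw.const_mul _).sub (integrable_const _)
  rw [integral_sub h3 h5,
    integral_sub (hw.const_mul _) (integrable_const _), integral_const_mul, ← hm] at h4
  simp only [integral_const, probReal_univ, one_smul] at h4
  change m ^ 2 ≤ ∫ t, (v t τ - u τ) ^ 2 ∂unif01
  nlinarith
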